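/- Let Gauge(M) denote the set of all gauge transformations on the class 𝔠_{PqNb}(M) of Poisson quasi-Nijenhuis structures with background on a smooth manifold M, and let 𝔊 : Ω²(M) → Gauge(M) assign to each 2-form B the gauge transformation determined by B. Then Gauge(M) is an abelian group under composition of maps: 𝔊(B₁)∘𝔊(B₂) = 𝔊(B₁+B₂) for all 2-forms B₁, B₂, the identity element is 𝔊(0), and the inverse of 𝔊(B) is 𝔊(−B); moreover 𝔊 is a group isomorphism from (Ω²(M), +) onto (Gauge(M), ∘). -/

import Mathlib

open scoped Manifold

noncomputable section

/-! ### Smooth functions, vector fields and tensor calculus on a manifold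

We work with the algebraic (Lie–Rinehart) presentation of the Cartan calculus of a
smooth manifold `M`:  smooth real functions form a commutative ring, vector fields are
the derivations of that ring, differential forms are alternating multilinear maps on
vector fields with values in functions, and all classical operations (`d`, interior
products, Lie derivatives, Nijenhuis torsion, concomitants, ...) are given by their
global Koszul-type formulas. -/

variable {EM : Type*} [NormedAddCommGroup EM] [NormedSpace ℝ EM]
  {HM : Type*} [TopologicalSpace HM] (IM : ModelWithCorners ℝ EM HM)
  (M : Type*) [TopologicalSpace M] [ChartedSpace HM M]

/-- The commutative ring of smooth real valued functions on `M`. -/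
abbrev SmoothR := C^(⊤ : ℕ∞)⟮IM, M; ℝ⟯

/-- Vector fields on `M`, presented as derivations of the ring of smooth functions. -/
abbrev VF := Derivation ℝ (SmoothR IM M) (SmoothR IM M)

/-- Covariant 1-tensors (raw). -/
abbrev Cov1 := VF IM M → SmoothR IM M

/-- Covariant 2-tensors (raw). -/
abbrev Cov2 := VF IM M → VF IM M → SmoothR IM M

/-- Covariant 3-tensors (raw). -/
abbrev Cov3 := VF IM M → VF IM M → VF IM M → SmoothR IM M

/-- Covariant 4-tensors (raw). -/
abbrev Cov4 := VF IM M → VF IM M → VF IM M → VF IM M → SmoothR IM M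

variable {IM M}

/-- A covariant 1-tensor is a (smooth) 1-form when it is `C^∞(M)`-linear. -/
def IsOneForm (α : Cov1 IM M) : Prop :=
  (∀ X Y, α (X + Y) = α X + α Y) ∧ ∀ (f : SmoothR IM M) X, α (f • X) = f * α X

/-- A covariant 2-tensor is a (smooth) 2-form when it is `C^∞(M)`-bilinear and
alternating. -/
def IsTwoForm (B : Cov2 IM M) : Prop :=
  (∀ X, IsOneForm (B X)) ∧ (∀ Y, IsOneForm fun X => B X Y) ∧ ∀ X, B X X = 0

/-- A covariant 3-tensor is a (smooth) 3-form when it is `C^∞(M)`-trilinear and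
alternating. -/
def IsThreeForm (φ : Cov3 IM M) : Prop :=
  (∀ X Y, IsOneForm (φ X Y)) ∧ (∀ X Z, IsOneForm fun Y => φ X Y Z) ∧
    (∀ Y Z, IsOneForm fun X => φ X Y Z) ∧
    (∀ X Y, φ X X Y = 0) ∧ (∀ X Y, φ X Y Y = 0) ∧ ∀ X Y, φ X Y X = 0

/-- A `(1,1)`-tensor is a `C^∞(M)`-linear endomorphism of vector fields. -/
def IsTensor11 (A : VF IM M → VF IM M) : Prop :=
  (∀ X Y, A (X + Y) = A X + A Y) ∧ ∀ (f : SmoothR IM M) X, A (f • X) = f • A X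

/-- The differential of a function, as a covariant 1-tensor. -/
def dF (f : SmoothR IM M) : Cov1 IM M := fun X => X f

/-- Exterior differential of a 1-tensor (Koszul formula). -/
def d1 (α : Cov1 IM M) : Cov2 IM M := fun X Y => X (α Y) - Y (α X) - α ⁅X, Y⁆

/-- Exterior differential of a 2-tensor (Koszul formula). -/
def d2 (B : Cov2 IM M) : Cov3 IM M := fun X Y Z =>
  X (B Y Z) - Y (B X Z) + Z (B X Y) - B ⁅X, Y⁆ Z + B ⁅X, Z⁆ Y - B ⁅Y, Z⁆ X

/-- Exterior differential of a 3-tensor (Koszul formula). -/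
def d3 (φ : Cov3 IM M) : Cov4 IM M := fun X Y Z W =>
  X (φ Y Z W) - Y (φ X Z W) + Z (φ X Y W) - W (φ X Y Z)
    - φ ⁅X, Y⁆ Z W + φ ⁅X, Z⁆ Y W - φ ⁅X, W⁆ Y Z
    - φ ⁅Y, Z⁆ X W + φ ⁅Y, W⁆ X Z - φ ⁅Z, W⁆ X Y

/-- Lie derivative of a 1-tensor along a vector field. -/
def lieDer (X : VF IM M) (α : Cov1 IM M) : Cov1 IM M := fun Y => X (α Y) - α ⁅X, Y⁆

/-- The transpose `Aᵗ` of a `(1,1)`-tensor acting on covariant 1-tensors. -/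
def transp (A : VF IM M → VF IM M) (α : Cov1 IM M) : Cov1 IM M := fun X => α (A X)

/-- The degree-zero derivation `ι_A` on 2-tensors. -/
def iota2 (A : VF IM M → VF IM M) (B : Cov2 IM M) : Cov2 IM M := fun X Y =>
  B (A X) Y + B X (A Y)

/-- The degree-zero derivation `ι_A` on 3-tensors. -/
def iota3 (A : VF IM M → VF IM M) (φ : Cov3 IM M) : Cov3 IM M := fun X Y Z =>
  φ (A X) Y Z + φ X (A Y) Z + φ X Y (A Z)

/-- The degree-zero derivation `ι_A` on 4-tensors. -/
def iota4 (A : VF IM M → VF IM M) (ω : Cov4 IM M) : Cov4 IM M := fun X Y Z W =>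
  ω (A X) Y Z W + ω X (A Y) Z W + ω X Y (A Z) W + ω X Y Z (A W)

/-- The derivation `d_A = ι_A ∘ d - d ∘ ι_A` on 2-tensors. -/
def dA2 (A : VF IM M → VF IM M) (B : Cov2 IM M) : Cov3 IM M :=
  iota3 A (d2 B) - d2 (iota2 A B)

/-- The derivation `d_A = ι_A ∘ d - d ∘ ι_A` on 3-tensors. -/
def dA3 (A : VF IM M → VF IM M) (φ : Cov3 IM M) : Cov4 IM M :=
  iota4 A (d3 φ) - d3 (iota3 A φ)

/-- The Nijenhuis torsion of a `(1,1)`-tensor. -/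
def torsion (A : VF IM M → VF IM M) (X Y : VF IM M) : VF IM M :=
  ⁅A X, A Y⁆ - A (⁅A X, Y⁆ + ⁅X, A Y⁆ - A ⁅X, Y⁆)

/-- A bivector field, encoded through its sharp map `P♯ : Ω¹(M) → 𝔛(M)`:
it is `C^∞(M)`-linear and skew-symmetric. -/
def IsBivector (P : Cov1 IM M → VF IM M) : Prop :=
  (∀ α β, P (α + β) = P α + P β) ∧ (∀ (f : SmoothR IM M) α, P (f • α) = f • P α) ∧
    ∀ α β : Cov1 IM M, IsOneForm α → IsOneForm β → α (P β) = - β (P α)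

/-- The function `P(α,β)` attached to a bivector `P` (through `P♯`) and two
covariant 1-tensors. -/
def bivFun (P : Cov1 IM M → VF IM M) (α β : Cov1 IM M) : SmoothR IM M := β (P α)

/-- The Poisson bracket of functions associated with a bivector. -/
def pbracket (P : Cov1 IM M → VF IM M) (f g : SmoothR IM M) : SmoothR IM M :=
  P (dF f) g

/-- A Poisson bivector: a bivector whose bracket of functions satisfies the Jacobi
identity (equivalently, `[P,P] = 0`). -/
def IsPoisson (P : Cov1 IM M → VF IM M) : Prop :=
  IsBivector P ∧ ∀ f g h : SmoothR IM M,
    pbracket P f (pbracket P g h) + pbracket P g (pbracket P h f)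
      + pbracket P h (pbracket P f g) = 0

/-- The concomitant `C_{P,A}` of a bivector `P` and a `(1,1)`-tensor `A`,
evaluated on two covariant 1-tensors; formula (1.8) of the paper. -/
def concom (P : Cov1 IM M → VF IM M) (A : VF IM M → VF IM M) (α β : Cov1 IM M) :
    Cov1 IM M :=
  lieDer (P β) (transp A α) - lieDer (P α) (transp A β)
    + transp A (lieDer (P α) β) - transp A (lieDer (P β) α)
    + dF (bivFun P (transp A α) β) - transp A (dF (bivFun P α β))

/-- The 3-form `ℋ^{S,T}(X,Y,Z) = Σ_{cyclic} H(SX,TY,Z)` built from a 3-tensor and two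
`(1,1)`-tensors. -/
def cyc (H : Cov3 IM M) (S T : VF IM M → VF IM M) : Cov3 IM M := fun X Y Z =>
  H (S X) (T Y) Z + H (S Y) (T Z) X + H (S Z) (T X) Y

/-- The 1-tensor `ι_{X∧Y}ω` (convention `ι_{X∧Y}ω = ι_Y ι_X ω`). -/
def ins2 (X Y : VF IM M) (ω : Cov3 IM M) : Cov1 IM M := fun Z => ω X Y Z

/-- `B_C(X,Y) = B(CX,Y)`. -/
def lcomp (B : Cov2 IM M) (C : VF IM M → VF IM M) : Cov2 IM M := fun X Y => B (C X) Y

/-- A Poisson quasi-Nijenhuis structure with background `(P,A,φ,H)` on `M`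
(Definition 1.1 of the paper): `P` is a Poisson bivector, `A` a `(1,1)`-tensor, `φ` and
`H` closed 3-forms, satisfying the four compatibility conditions (2.1)–(2.4). -/
def IsPqNb (P : Cov1 IM M → VF IM M) (A : VF IM M → VF IM M) (φ H : Cov3 IM M) : Prop :=
  IsPoisson P ∧ IsTensor11 A ∧
    IsThreeForm φ ∧ d3 φ = 0 ∧ IsThreeForm H ∧ d3 H = 0 ∧
    (∀ α : Cov1 IM M, IsOneForm α → A (P α) = P (transp A α)) ∧
    (∀ α β : Cov1 IM M, IsOneForm α → IsOneForm β →
      concom P A α β = fun Z => - H (P α) (P β) Z) ∧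
    (∀ X Y, torsion A X Y =
      P (fun Z => φ X Y Z + H (A X) Y Z + H X (A Y) Z)) ∧
    dA3 A φ = d3 (cyc H A A)


variable (IM M) in
/-- Quadruples of tensors `(P, A, φ, H)` of the types entering a Poisson
quasi-Nijenhuis structure with background. -/
abbrev PqNbQuad :=
  (Cov1 IM M → VF IM M) × (VF IM M → VF IM M) × Cov3 IM M × Cov3 IM M

/-- A quadruple belonging to the class `𝔠_{PqNb}(M)`. -/
def IsPqNbQ (q : PqNbQuad IM M) : Prop := IsPqNb q.1 q.2.1 q.2.2.1 q.2.2.2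

/-- The gauge transformation determined by a 2-form `B`:
`(P, A, φ, H) ↦ (P, A + C, φ - dB_C - d(ι_A B), H + dB)` where `C = P♯ ∘ B♭`. -/
def gaugeT (B : Cov2 IM M) (q : PqNbQuad IM M) : PqNbQuad IM M :=
  (q.1, fun X => q.2.1 X + q.1 (B X),
    q.2.2.1 - d2 (lcomp B fun X => q.1 (B X)) - d2 (iota2 q.2.1 B),
    q.2.2.2 + d2 B)

section Calculus

set_option linter.unusedSimpArgs false

lemma IsOneForm.map_zero' {α : Cov1 IM M} (h : IsOneForm α) : α 0 = 0 := by
  have := h.2 0 0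
  simpa using this

lemma IsOneForm.map_neg' {α : Cov1 IM M} (h : IsOneForm α) (X) : α (-X) = - α X := by
  have := h.1 X (-X)
  rw [add_neg_cancel, h.map_zero'] at this
  exact (neg_eq_of_add_eq_zero_right this.symm).symm

lemma IsOneForm.map_sub' {α : Cov1 IM M} (h : IsOneForm α) (X Y) : α (X - Y) = α X - α Y := by
  rw [sub_eq_add_neg, h.1, h.map_neg', sub_eq_add_neg]

lemma isOneForm_dF (f : SmoothR IM M) : IsOneForm (dF f) :=
  ⟨fun _ _ => rfl, fun _ _ => rfl⟩

lemma IsOneForm.add {α β : Cov1 IM M} (h : IsOneForm α) (k : IsOneForm β) :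
    IsOneForm (α + β) :=
  ⟨fun X Y => by simp only [Pi.add_apply, h.1, k.1]; ring,
   fun f X => by simp only [Pi.add_apply, h.2, k.2]; ring⟩

lemma IsOneForm.neg {α : Cov1 IM M} (h : IsOneForm α) :
    IsOneForm (-α) :=
  ⟨fun X Y => by simp only [Pi.neg_apply, h.1]; ring,
   fun f X => by simp only [Pi.neg_apply, h.2]; ring⟩

lemma IsOneForm.transp {α : Cov1 IM M} (h : IsOneForm α) {A : VF IM M → VF IM M}
    (hA : IsTensor11 A) : IsOneForm (transp A α) :=
  ⟨fun X Y => by simp only [_root_.transp, hA.1, h.1],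
   fun f X => by simp only [_root_.transp, hA.2, h.2]⟩

lemma IsTensor11.map_zero' {A : VF IM M → VF IM M} (h : IsTensor11 A) : A 0 = 0 := by
  have := h.2 0 0
  simpa using this

lemma IsTensor11.map_neg' {A : VF IM M → VF IM M} (h : IsTensor11 A) (X) : A (-X) = - A X := by
  have := h.1 X (-X)
  rw [add_neg_cancel, h.map_zero'] at this
  exact (neg_eq_of_add_eq_zero_right this.symm).symm

lemma IsTensor11.map_sub' {A : VF IM M → VF IM M} (h : IsTensor11 A) (X Y) :
    A (X - Y) = A X - A Y := by
  rw [sub_eq_add_neg, h.1, h.map_neg', sub_eq_add_neg]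

lemma IsTwoForm.addl {B : Cov2 IM M} (h : IsTwoForm B) (Z X Y) :
    B (X + Y) Z = B X Z + B Y Z := (h.2.1 Z).1 X Y

lemma IsTwoForm.smull {B : Cov2 IM M} (h : IsTwoForm B) (Z) (f : SmoothR IM M) (X) :
    B (f • X) Z = f * B X Z := (h.2.1 Z).2 f X

lemma IsTwoForm.subl {B : Cov2 IM M} (h : IsTwoForm B) (Z X Y) :
    B (X - Y) Z = B X Z - B Y Z := (h.2.1 Z).map_sub' X Y

lemma IsTwoForm.negl {B : Cov2 IM M} (h : IsTwoForm B) (Z X) :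
    B (-X) Z = - B X Z := (h.2.1 Z).map_neg' X

lemma vlie_add (X Y Z : VF IM M) : ⁅X, Y + Z⁆ = ⁅X, Y⁆ + ⁅X, Z⁆ := lie_add X Y Z

lemma vadd_lie (X Y Z : VF IM M) : ⁅X + Y, Z⁆ = ⁅X, Z⁆ + ⁅Y, Z⁆ := add_lie X Y Z

lemma vlie_self (X : VF IM M) : ⁅X, X⁆ = 0 := lie_self X

lemma vlie_skew (X Y : VF IM M) : ⁅X, Y⁆ = - ⁅Y, X⁆ := (lie_skew X Y).symm

lemma IsTwoForm.skew {B : Cov2 IM M} (h : IsTwoForm B) (X Y) : B X Y = - B Y X := by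
  have := h.2.2 (X + Y)
  rw [(h.1 _).1, h.addl, h.addl, h.2.2, h.2.2] at this
  linear_combination this

lemma smul_lie' (f : SmoothR IM M) (X Y : VF IM M) : ⁅f • X, Y⁆ = f • ⁅X, Y⁆ - (Y f) • X := by
  ext1 g
  simp only [Derivation.commutator_apply, Derivation.sub_apply, Derivation.smul_apply, smul_eq_mul,
    Derivation.leibniz]
  ring

lemma lie_smul' (f : SmoothR IM M) (X Y : VF IM M) : ⁅X, f • Y⁆ = f • ⁅X, Y⁆ + (X f) • Y := by
  ext1 g
  simp only [Derivation.commutator_apply, Derivation.add_apply, Derivation.smul_apply, smul_eq_mul,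
    Derivation.leibniz]
  ring

lemma isThreeForm_d2 {B : Cov2 IM M} (h : IsTwoForm B) : IsThreeForm (d2 B) := by
  have a1 := fun X => (h.1 X).1
  have a2 := fun X => (h.1 X).2
  have b1 := h.addl
  have b2 := h.smull
  have b3 := h.subl
  have b4 := h.negl
  have b0 := fun X => (h.2.1 X).map_zero'
  have z := h.2.2
  have s := h.skew
  refine ⟨fun X Y => ⟨fun Z W => ?_, fun f Z => ?_⟩, fun X Y => ⟨fun Z W => ?_, fun f Z => ?_⟩,
    fun X Y => ⟨fun Z W => ?_, fun f Z => ?_⟩, fun X Y => ?_, fun X Y => ?_, fun X Y => ?_⟩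
  · simp only [d2, a1, b1, vlie_add, vadd_lie, map_add, Derivation.add_apply]; ring
  · simp only [d2, a2, a1, b1, b2, b3, smul_lie', lie_smul', Derivation.leibniz, Derivation.smul_apply,
      smul_eq_mul]
    rw [s Z X, s Z Y]; ring
  · simp only [d2, a1, b1, vlie_add, vadd_lie, map_add, Derivation.add_apply]; ring
  · simp only [d2, a2, a1, b1, b2, b3, smul_lie', lie_smul', Derivation.leibniz, Derivation.smul_apply,
      smul_eq_mul]
    rw [s Z X]; ring
  · simp only [d2, a1, b1, vlie_add, vadd_lie, map_add, Derivation.add_apply]; ring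
  · simp only [d2, a2, a1, b1, b2, b3, smul_lie', lie_smul', Derivation.leibniz, Derivation.smul_apply,
      smul_eq_mul]
    rw [s Z X, s Z Y]; ring
  · simp only [d2, vlie_self, b0, z, map_zero]; ring
  · simp only [d2, vlie_self, b0, z, map_zero]; ring
  · simp only [d2, vlie_self, b0, z, map_zero]
    rw [vlie_skew Y X, b4, s Y X, map_neg]; ring

lemma d3_d2 {B : Cov2 IM M} (h : IsTwoForm B) : d3 (d2 B) = 0 := by
  have s := h.skew
  have J : ∀ X Y Z W : VF IM M, B ⁅⁅X, Y⁆, Z⁆ W - B ⁅⁅X, Z⁆, Y⁆ W + B ⁅⁅Y, Z⁆, X⁆ W = 0 := by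
    intro X Y Z W
    rw [← h.subl, ← h.addl, show ⁅⁅X, Y⁆, Z⁆ - ⁅⁅X, Z⁆, Y⁆ + ⁅⁅Y, Z⁆, X⁆ = 0 from ?_,
      (h.2.1 W).map_zero']
    ext1 g
    simp only [Derivation.commutator_apply, Derivation.sub_apply, Derivation.add_apply, map_sub,
      Derivation.coe_zero, Pi.zero_apply]
    ring
  funext X Y Z W
  simp only [d3, d2, map_sub, map_add, Derivation.commutator_apply (D1 := X),
    Derivation.commutator_apply (D1 := Y), Derivation.commutator_apply (D1 := Z), Pi.zero_apply]
  linear_combination J X Y Z W - J X Y W Z + J X Z W Y - J Y Z W X + s ⁅X, Y⁆ ⁅Z, W⁆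
    - s ⁅X, Z⁆ ⁅Y, W⁆ + s ⁅X, W⁆ ⁅Y, Z⁆

lemma d2_add (B B' : Cov2 IM M) : d2 (B + B') = d2 B + d2 B' := by
  funext X Y Z
  simp only [d2, Pi.add_apply, map_add]; ring

lemma d2_zero : d2 (0 : Cov2 IM M) = 0 := by
  funext X Y Z
  simp [d2]

lemma d3_add (B B' : Cov3 IM M) : d3 (B + B') = d3 B + d3 B' := by
  funext X Y Z W
  simp only [d3, Pi.add_apply, map_add]; ring

lemma d3_sub (B B' : Cov3 IM M) : d3 (B - B') = d3 B - d3 B' := by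
  funext X Y Z W
  simp only [d3, Pi.sub_apply, map_sub]; ring

/-- polarized torsion -/
def tors2 (A C : VF IM M → VF IM M) (X Y : VF IM M) : VF IM M :=
  ⁅A X, C Y⁆ + ⁅C X, A Y⁆ - A (⁅C X, Y⁆ + ⁅X, C Y⁆ - C ⁅X, Y⁆) - C (⁅A X, Y⁆ + ⁅X, A Y⁆ - A ⁅X, Y⁆)

/-- `B(A·,C·) + B(C·,A·) + ι_{AC} B + ι_{CA} B` -/
def bb (B : Cov2 IM M) (A C : VF IM M → VF IM M) : Cov2 IM M := fun X Y =>
  B (A X) (C Y) + B (C X) (A Y) + B (A (C X)) Y + B X (A (C Y)) + B (C (A X)) Y + B X (C (A Y))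

lemma F2 {B : Cov2 IM M} (h : IsTwoForm B) {A C : VF IM M → VF IM M} (hA : IsTensor11 A)
    (hC : IsTensor11 C) (X Y Z : VF IM M) :
    cyc (d2 B) A C X Y Z + cyc (d2 B) C A X Y Z - iota3 A (d2 (iota2 C B)) X Y Z
      - iota3 C (d2 (iota2 A B)) X Y Z + d2 (bb B A C) X Y Z
    = - (B (tors2 A C X Y) Z + B (tors2 A C Y Z) X + B (tors2 A C Z X) Y) := by
  have b1 := h.addl
  have b3 := h.subl
  have b4 := h.negl
  have s := h.skew
  have sk := vlie_skew (IM := IM) (M := M)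
  simp only [cyc, d2, iota3, iota2, bb, tors2, b1, b3, hA.1, hA.map_sub', hC.1, hC.map_sub', map_add]
  rw [sk Z X, sk (A Z) (C X), sk (C Z) (A X), sk (A Z) X, sk (C Z) X, sk Z (A X), sk Z (C X),
    sk (A Z) Y, sk (C Z) Y, sk (A Y) X, sk (C Y) X]
  simp only [hA.map_neg', hC.map_neg', b4, s Z, s (A Z), s (C Z), s (A Y) X, s (C Y) X, s Y X,
    s Y (A X), s Y (C X), s (A Y) (C X), s (C Y) (A X), s _ (A (C _)), s _ (C (A _)), map_neg]
  ring

end Calculus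
section Poisson

lemma IsThreeForm.skew12 {H : Cov3 IM M} (h : IsThreeForm H) (X Y Z) : H X Y Z = - H Y X Z := by
  have := h.2.2.2.1 (X + Y) Z
  rw [show H (X + Y) (X + Y) Z = H X (X + Y) Z + H Y (X + Y) Z from (h.2.2.1 _ _).1 _ _,
    show H X (X + Y) Z = H X X Z + H X Y Z from (h.2.1 _ _).1 _ _,
    show H Y (X + Y) Z = H Y X Z + H Y Y Z from (h.2.1 _ _).1 _ _, h.2.2.2.1, h.2.2.2.1] at this
  linear_combination this

lemma IsThreeForm.skew23 {H : Cov3 IM M} (h : IsThreeForm H) (X Y Z) : H X Y Z = - H X Z Y := by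
  have := h.2.2.2.2.1 X (Y + Z)
  rw [show H X (Y + Z) (Y + Z) = H X Y (Y + Z) + H X Z (Y + Z) from (h.2.1 _ _).1 _ _,
    (h.1 _ _).1, (h.1 _ _).1, h.2.2.2.2.1, h.2.2.2.2.1] at this
  linear_combination this

lemma IsOneForm.lieDer {α : Cov1 IM M} (h : IsOneForm α) (X : VF IM M) :
    IsOneForm (lieDer X α) :=
  ⟨fun Y Z => by simp only [_root_.lieDer, vlie_add, h.1, map_add]; ring,
   fun f Y => by
    simp only [_root_.lieDer, lie_smul', h.1, h.2, Derivation.leibniz, smul_eq_mul]; ring⟩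

lemma IsBivector.zero {P : Cov1 IM M → VF IM M} (h : IsBivector P) : P 0 = 0 := by
  have := h.2.1 0 0
  simpa using this

lemma IsBivector.neg {P : Cov1 IM M → VF IM M} (h : IsBivector P) (α) : P (-α) = - P α := by
  have := h.1 α (-α)
  rw [add_neg_cancel, h.zero] at this
  exact (neg_eq_of_add_eq_zero_right this.symm).symm

lemma IsBivector.sub {P : Cov1 IM M → VF IM M} (h : IsBivector P) (α β) :
    P (α - β) = P α - P β := by
  rw [sub_eq_add_neg, h.1, h.neg, sub_eq_add_neg]

lemma IsBivector.apply {P : Cov1 IM M → VF IM M} (h : IsBivector P) {α} (hα : IsOneForm α) (f) :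
    P α f = - α (P (dF f)) := h.2.2 _ _ (isOneForm_dF f) hα

/-- Koszul bracket of 1-forms -/
def kos (P : Cov1 IM M → VF IM M) (α β : Cov1 IM M) : Cov1 IM M :=
  lieDer (P α) β + - lieDer (P β) α + - dF (β (P α))

lemma isOneForm_kos (P : Cov1 IM M → VF IM M) {α β : Cov1 IM M} (hα : IsOneForm α)
    (hβ : IsOneForm β) : IsOneForm (kos P α β) :=
  ((hβ.lieDer _).add (hα.lieDer _).neg).add (isOneForm_dF _).neg

lemma jac_formula {P : Cov1 IM M → VF IM M} (h : IsBivector P) {α β γ : Cov1 IM M}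
    (hα : IsOneForm α) (hβ : IsOneForm β) (hγ : IsOneForm γ) :
    γ (⁅P α, P β⁆ - P (kos P α β)) = γ ⁅P α, P β⁆ + β ⁅P γ, P α⁆ + α ⁅P β, P γ⁆
      + P α (β (P γ)) + P β (γ (P α)) + P γ (α (P β)) := by
  rw [hγ.map_sub', h.2.2 γ _ hγ (isOneForm_kos P hα hβ), h.2.2 γ α hγ hα, h.2.2 α β hα hβ,
    vlie_skew (P γ) (P α), hβ.map_neg', map_neg, map_neg]
  simp only [kos, lieDer, dF, Pi.add_apply, Pi.neg_apply]
  ring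

lemma sharp_kos {P : Cov1 IM M → VF IM M} (h : IsPoisson P) {α β : Cov1 IM M}
    (hα : IsOneForm α) (hβ : IsOneForm β) : P (kos P α β) = ⁅P α, P β⁆ := by
  have hb := h.1
  have key : ∀ {α β γ : Cov1 IM M}, IsOneForm α → IsOneForm β → IsOneForm γ →
      γ (⁅P α, P β⁆ - P (kos P α β)) = β (⁅P γ, P α⁆ - P (kos P γ α)) := by
    intro α β γ hα hβ hγ
    rw [jac_formula hb hα hβ hγ, jac_formula hb hγ hα hβ]; ring
  have s1 : ∀ f g, ⁅P (dF f), P (dF g)⁆ - P (kos P (dF f) (dF g)) = 0 := by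
    intro f g
    ext1 k
    have := jac_formula hb (isOneForm_dF f) (isOneForm_dF g) (isOneForm_dF k)
    have J := h.2 f g k
    simp only [dF, Derivation.commutator_apply] at this
    simp only [pbracket] at J
    refine this.trans ?_
    simp only [Derivation.coe_zero, Pi.zero_apply]
    linear_combination J
  have s2 : ∀ f, ∀ {β : Cov1 IM M}, IsOneForm β →
      ⁅P (dF f), P β⁆ - P (kos P (dF f) β) = 0 := by
    intro f β hβ
    ext1 k
    refine (key (isOneForm_dF f) hβ (isOneForm_dF k)).trans ?_
    rw [s1, hβ.map_zero']; rfl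
  symm
  rw [← sub_eq_zero]
  ext1 k
  refine (key hα hβ (isOneForm_dF k)).trans ?_
  rw [s2 _ hα, hβ.map_zero']; rfl

variable {P : Cov1 IM M → VF IM M} {B : Cov2 IM M}

lemma isTensor11_C (h : IsBivector P) (hB : IsTwoForm B) : IsTensor11 fun X => P (B X) :=
  ⟨fun X Y => by
    rw [← h.1]; refine congrArg P ?_; funext Z; exact hB.addl Z X Y,
   fun f X => by
    rw [← h.2.1]; refine congrArg P ?_; funext Z; exact hB.smull Z f X⟩

/-- transferring `P♯B♭` -/
lemma pair_C (h : IsBivector P) (hB : IsTwoForm B) {α} (hα : IsOneForm α) (X) :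
    α (P (B X)) = B (P α) X := by
  rw [h.2.2 α _ hα (hB.1 X), hB.skew X]; ring

lemma C_sharp (h : IsBivector P) (hB : IsTwoForm B) {α} (hα : IsOneForm α) :
    P (B (P α)) = P (transp (fun X => P (B X)) α) := by
  congr 1; funext X; exact (pair_C h hB hα X).symm

lemma concom_C (h : IsPoisson P) (hB : IsTwoForm B) {α β} (hα : IsOneForm α)
    (hβ : IsOneForm β) :
    concom P (fun X => P (B X)) α β = fun Z => - d2 B (P α) (P β) Z := by
  have hC := isTensor11_C h.1 hB
  funext Z
  have k : kos P α β (P (B Z)) = B ⁅P α, P β⁆ Z := by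
    rw [pair_C h.1 hB (isOneForm_kos P hα hβ), sharp_kos h hα hβ]
  have e : β (P (transp (fun X => P (B X)) α)) = - B (P α) (P β) := by
    rw [h.1.2.2 β _ hβ (hα.transp hC), transp, pair_C h.1 hB hα]
  simp only [kos, lieDer, dF, Pi.add_apply, Pi.neg_apply] at k
  simp only [concom, lieDer, bivFun, dF, Pi.add_apply, Pi.sub_apply, e, d2, map_neg]
  simp only [transp, lieDer, dF, pair_C h.1 hB hα, pair_C h.1 hB hβ] at k ⊢
  rw [hB.skew ⁅P α, Z⁆, hB.skew ⁅P β, Z⁆]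
  linear_combination k

lemma dual_concom (h : IsBivector P) {A : VF IM M → VF IM M} (hA : IsTensor11 A)
    {H : Cov3 IM M} (hH : IsThreeForm H)
    (h1 : ∀ α : Cov1 IM M, IsOneForm α → A (P α) = P (transp A α))
    (h2 : ∀ α β : Cov1 IM M, IsOneForm α → IsOneForm β →
      concom P A α β = fun Z => - H (P α) (P β) Z) {α} (hα : IsOneForm α) (X) :
    ⁅P α, A X⁆ - A ⁅P α, X⁆ =
      P (- lieDer (A X) α + lieDer X (transp A α) + H (P α) X) := by
  ext1 f
  rw [h.apply (((hα.lieDer _).neg.add ((hα.transp hA).lieDer _)).add (hH.1 _ _))]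
  have c := congrFun (h2 α (dF f) hα (isOneForm_dF f)) X
  have e1 : α (P (dF f)) = - P α f := h.2.2 _ _ hα (isOneForm_dF f)
  have e2 : α (A (P (dF f))) = - (A (P α)) f := by
    rw [h1 _ (isOneForm_dF f), h.2.2 _ _ hα ((isOneForm_dF f).transp hA)]; rfl
  simp only [concom, lieDer, bivFun, dF, transp, Pi.add_apply, Pi.sub_apply, Pi.neg_apply,
    Derivation.sub_apply, Derivation.commutator_apply] at c ⊢
  have e3 : P (transp A α) = A (P α) := (h1 α hα).symm
  rw [e3] at c
  rw [e1, e2, vlie_skew (A X), vlie_skew X, hA.map_neg', hα.map_neg', hα.map_neg', map_neg, map_neg,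
    hH.skew23]
  linear_combination -c

lemma tors2_C (h : IsBivector P) (hB : IsTwoForm B) {A : VF IM M → VF IM M} (hA : IsTensor11 A)
    {H : Cov3 IM M} (hH : IsThreeForm H)
    (h1 : ∀ α : Cov1 IM M, IsOneForm α → A (P α) = P (transp A α))
    (h2 : ∀ α β : Cov1 IM M, IsOneForm α → IsOneForm β →
      concom P A α β = fun Z => - H (P α) (P β) Z) (X Y) :
    tors2 A (fun X => P (B X)) X Y =
      P (fun Z => - d2 (iota2 A B) X Y Z + d2 B (A X) Y Z + d2 B X (A Y) Z
        + H (P (B X)) Y Z + H X (P (B Y)) Z) := by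
  have dX := dual_concom h hA hH h1 h2 (hB.1 X) Y
  have dY := dual_concom h hA hH h1 h2 (hB.1 Y) X
  have hC := isTensor11_C h hB
  have e : (fun Z => - d2 (iota2 A B) X Y Z + d2 B (A X) Y Z + d2 B X (A Y) Z
        + H (P (B X)) Y Z + H X (P (B Y)) Z) =
      (- lieDer (A Y) (B X) + lieDer Y (transp A (B X)) + H (P (B X)) Y)
      - (- lieDer (A X) (B Y) + lieDer X (transp A (B Y)) + H (P (B Y)) X)
      + transp A (B ⁅X, Y⁆) - (B ⁅A X, Y⁆ + B ⁅X, A Y⁆ - B (A ⁅X, Y⁆)) := by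
    funext Z
    simp only [d2, iota2, lieDer, transp, Pi.add_apply, Pi.sub_apply, Pi.neg_apply, map_add]
    rw [hH.skew12 X, hB.skew X ⁅A Y, Z⁆, hB.skew X (A ⁅Y, Z⁆), hB.skew Y ⁅A X, Z⁆,
      hB.skew Y (A ⁅X, Z⁆), hB.skew ⁅Y, Z⁆ (A X), hB.skew ⁅X, Z⁆ (A Y)]
    ring
  rw [e, h.sub, h.1 (_ - _), h.sub (_ + _) (_ + _), ← dX, ← dY, h.sub, h.1, ← h1 _ (hB.1 _)]
  simp only [tors2, hA.1, hA.map_sub']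
  have g : P (B (⁅A X, Y⁆ + ⁅X, A Y⁆ - A ⁅X, Y⁆))
      = P (B ⁅A X, Y⁆) + P (B ⁅X, A Y⁆) - P (B (A ⁅X, Y⁆)) :=
    (hC.map_sub' _ _).trans (congrArg (fun V => V - P (B (A ⁅X, Y⁆))) (hC.1 _ _))
  rw [g, vlie_skew (P (B Y)) (A X), vlie_skew (P (B Y)) X, hA.map_neg']
  abel

end Poisson
section Preservation

lemma IsThreeForm.add1 {H : Cov3 IM M} (h : IsThreeForm H) (X X' Y Z) :
    H (X + X') Y Z = H X Y Z + H X' Y Z := (h.2.2.1 Y Z).1 X X'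

lemma IsThreeForm.add2 {H : Cov3 IM M} (h : IsThreeForm H) (X Y Y' Z) :
    H X (Y + Y') Z = H X Y Z + H X Y' Z := (h.2.1 X Z).1 Y Y'

lemma IsThreeForm.add3 {H : Cov3 IM M} (h : IsThreeForm H) (X Y Z Z') :
    H X Y (Z + Z') = H X Y Z + H X Y Z' := (h.1 X Y).1 Z Z'

lemma IsThreeForm.add {H K : Cov3 IM M} (h : IsThreeForm H) (k : IsThreeForm K) :
    IsThreeForm (H + K) := by
  refine ⟨fun X Y => (h.1 X Y).add (k.1 X Y), fun X Z => (h.2.1 X Z).add (k.2.1 X Z),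
    fun Y Z => (h.2.2.1 Y Z).add (k.2.2.1 Y Z), fun X Y => ?_, fun X Y => ?_, fun X Y => ?_⟩
  · simp only [Pi.add_apply, h.2.2.2.1, k.2.2.2.1, add_zero]
  · simp only [Pi.add_apply, h.2.2.2.2.1, k.2.2.2.2.1, add_zero]
  · simp only [Pi.add_apply, h.2.2.2.2.2, k.2.2.2.2.2, add_zero]

lemma IsThreeForm.neg {H : Cov3 IM M} (h : IsThreeForm H) :
    IsThreeForm (-H) := by
  refine ⟨fun X Y => (h.1 X Y).neg, fun X Z => (h.2.1 X Z).neg,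
    fun Y Z => (h.2.2.1 Y Z).neg, fun X Y => ?_, fun X Y => ?_, fun X Y => ?_⟩
  · simp only [Pi.neg_apply, h.2.2.2.1, neg_zero]
  · simp only [Pi.neg_apply, h.2.2.2.2.1, neg_zero]
  · simp only [Pi.neg_apply, h.2.2.2.2.2, neg_zero]

lemma IsThreeForm.sub {H K : Cov3 IM M} (h : IsThreeForm H) (k : IsThreeForm K) :
    IsThreeForm (H - K) := by
  rw [sub_eq_add_neg]; exact h.add k.neg

lemma IsTwoForm.add {B B' : Cov2 IM M} (h : IsTwoForm B) (k : IsTwoForm B') :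
    IsTwoForm (B + B') := by
  refine ⟨fun X => (h.1 X).add (k.1 X), fun X => (h.2.1 X).add (k.2.1 X), fun X => ?_⟩
  simp only [Pi.add_apply, h.2.2, k.2.2, add_zero]

variable {A C : VF IM M → VF IM M} {B : Cov2 IM M} {P : Cov1 IM M → VF IM M}

lemma IsTensor11.add (hA : IsTensor11 A) (hC : IsTensor11 C) :
    IsTensor11 fun X => A X + C X :=
  ⟨fun X Y => by simp only [hA.1, hC.1]; abel, fun f X => by simp only [hA.2, hC.2, smul_add]⟩

lemma IsTensor11.comp (hA : IsTensor11 A) (hC : IsTensor11 C) :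
    IsTensor11 fun X => A (C X) :=
  ⟨fun X Y => by simp only [hA.1, hC.1], fun f X => by simp only [hA.2, hC.2]⟩

lemma isTwoForm_iota2 (hB : IsTwoForm B) (hA : IsTensor11 A) : IsTwoForm (iota2 A B) := by
  refine ⟨fun X => (hB.1 (A X)).add ((hB.1 X).transp hA),
    fun X => ((hB.2.1 X).transp hA).add (hB.2.1 (A X)), fun X => ?_⟩
  simp only [iota2]; rw [hB.skew X]; ring

lemma isTwoForm_bb (hB : IsTwoForm B) (hA : IsTensor11 A) (hC : IsTensor11 C) :
    IsTwoForm (bb B A C) := by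
  have e : IsTwoForm (fun X Y => B (A X) (C Y) + B (C X) (A Y)) := by
    refine ⟨fun X => ((hB.1 (A X)).transp hC).add ((hB.1 (C X)).transp hA),
      fun X => ((hB.2.1 (C X)).transp hA).add ((hB.2.1 (A X)).transp hC), fun X => ?_⟩
    change B (A X) (C X) + B (C X) (A X) = 0
    rw [hB.skew (C X)]; ring
  have := (e.add (isTwoForm_iota2 hB (hA.comp hC))).add (isTwoForm_iota2 hB (hC.comp hA))
  convert this using 1
  funext X Y
  simp only [bb, iota2, Pi.add_apply]; ring

lemma isTwoForm_lcomp (h : IsBivector P) (hB : IsTwoForm B) :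
    IsTwoForm (lcomp B fun X => P (B X)) := by
  have hC := isTensor11_C h hB
  refine ⟨fun X => hB.1 _, fun X => (hB.2.1 X).transp hC, fun X => ?_⟩
  have e1 := pair_C h hB (hB.1 X) X
  have e2 := hB.skew X (P (B X))
  have e3 : (2 : ℝ) • B (P (B X)) X = 0 := by
    rw [two_smul]; linear_combination e2 - e1
  exact (smul_eq_zero.mp e3).resolve_left two_ne_zero

lemma iota2_C (h : IsBivector P) (hB : IsTwoForm B) :
    iota2 (fun X => P (B X)) B = lcomp B (fun X => P (B X)) + lcomp B (fun X => P (B X)) := by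
  funext X Y
  simp only [iota2, lcomp, Pi.add_apply, pair_C h hB (hB.1 X)]

lemma iota3_add {ψ : Cov3 IM M} (h : IsThreeForm ψ) (X Y Z) :
    iota3 (fun X => A X + C X) ψ X Y Z = iota3 A ψ X Y Z + iota3 C ψ X Y Z := by
  simp only [iota3, h.add1, h.add2, h.add3]; ring

lemma cyc_add {ψ : Cov3 IM M} (h : IsThreeForm ψ) (X Y Z) :
    cyc ψ (fun X => A X + C X) (fun X => A X + C X) X Y Z
      = cyc ψ A A X Y Z + cyc ψ A C X Y Z + cyc ψ C A X Y Z + cyc ψ C C X Y Z := by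
  simp only [cyc, h.add1, h.add2]; ring

lemma cyc_sum1 {ψ : Cov3 IM M} (h : IsThreeForm ψ) (X Y Z) :
    ψ X Y (C Z) + ψ Y Z (C X) + ψ Z X (C Y) = iota3 C ψ X Y Z := by
  simp only [iota3]
  rw [h.skew23 Y Z, h.skew12 Y, h.skew12 Z, h.skew23 X Z]; ring

lemma cyc_sum2 {ψ : Cov3 IM M} (h : IsThreeForm ψ) (X Y Z) :
    (ψ (A X) Y (C Z) + ψ X (A Y) (C Z)) + (ψ (A Y) Z (C X) + ψ Y (A Z) (C X))
      + (ψ (A Z) X (C Y) + ψ Z (A X) (C Y)) = cyc ψ A C X Y Z + cyc ψ C A X Y Z := by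
  have r : ∀ X Y Z, ψ X Y Z = ψ Z X Y := by
    intro X Y Z; rw [h.skew23, h.skew12, neg_neg]
  simp only [cyc]
  rw [r (A X) Y, r (A Y) Z, r (A Z) X, ← r (A Y) (C Z) X, ← r (A Z) (C X) Y, ← r (A X) (C Y) Z]
  ring

lemma tors2_self (A : VF IM M → VF IM M) (X Y) : tors2 A A X Y = torsion A X Y + torsion A X Y := by
  simp only [tors2, torsion]; abel

lemma torsion_add (hA : IsTensor11 A) (hC : IsTensor11 C) (X Y) :
    torsion (fun X => A X + C X) X Y = torsion A X Y + tors2 A C X Y + torsion C X Y := by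
  simp only [tors2, torsion, hA.1, hC.1, hA.map_sub', hC.map_sub', vlie_add, vadd_lie]; abel

lemma torsion_C (h : IsPoisson P) (hB : IsTwoForm B) (X Y) :
    torsion (fun X => P (B X)) X Y = P (fun Z => - d2 (lcomp B (fun X => P (B X))) X Y Z
      + d2 B (P (B X)) Y Z + d2 B X (P (B Y)) Z) := by
  have hC := isTensor11_C h.1 hB
  have t := tors2_C h.1 hB hC (isThreeForm_d2 hB) (fun α hα => C_sharp h.1 hB hα)
    (fun α β hα hβ => concom_C h hB hα hβ) X Y
  have e : (2 : ℝ) • torsion (fun X => P (B X)) X Y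
      = (2 : ℝ) • P (fun Z => - d2 (lcomp B (fun X => P (B X))) X Y Z
      + d2 B (P (B X)) Y Z + d2 B X (P (B Y)) Z) := by
    rw [two_smul, two_smul, ← tors2_self (fun X => P (B X)), t, ← h.1.1, iota2_C h.1 hB, d2_add]
    congr 1
    funext Z
    simp only [Pi.add_apply]; ring
  exact smul_right_injective _ (two_ne_zero (α := ℝ)) e

lemma d3_smul (c : ℝ) (φ : Cov3 IM M) : d3 (c • φ) = c • d3 φ := by
  funext X Y Z W
  simp only [d3, Pi.smul_apply, Derivation.map_smul, smul_add, smul_sub]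

lemma concom_add (h : IsBivector P) {α β : Cov1 IM M} (hα : IsOneForm α) (hβ : IsOneForm β) (X) :
    concom P (fun X => A X + C X) α β X = concom P A α β X + concom P C α β X := by
  have e : P (transp (fun X => A X + C X) α) = P (transp A α) + P (transp C α) := by
    rw [← h.1]; congr 1; funext Z; exact hα.1 _ _
  have la := (hα.lieDer (P β)).1
  have lb := (hβ.lieDer (P α)).1
  simp only [concom, bivFun, e, hβ.1, Pi.add_apply, Pi.sub_apply]
  simp only [lieDer, transp, dF, hα.1, hβ.1, map_add, Derivation.add_apply, vlie_add]
  ring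

lemma preserve (hB : IsTwoForm B) {φ H : Cov3 IM M} (h : IsPqNb P A φ H) :
    IsPqNb P (fun X => A X + P (B X))
      (φ - d2 (lcomp B fun X => P (B X)) - d2 (iota2 A B)) (H + d2 B) := by
  obtain ⟨hP, hA, hφ, dφ, hH, dH, h1, h2, h3, h4⟩ := h
  have hC := isTensor11_C hP.1 hB
  have hl := isTwoForm_lcomp hP.1 hB
  have hi := isTwoForm_iota2 hB hA
  have hlt := isThreeForm_d2 hl
  have hit := isThreeForm_d2 hi
  have hBt := isThreeForm_d2 hB
  have hφ' := (hφ.sub hlt).sub hit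
  have hdφ' : d3 (φ - d2 (lcomp B fun X => P (B X)) - d2 (iota2 A B)) = 0 := by
    rw [d3_sub, d3_sub, dφ, d3_d2 hl, d3_d2 hi, sub_zero, sub_zero]
  have T := tors2_C hP.1 hB hA hH h1 h2
  have TC := torsion_C hP hB
  refine ⟨hP, hA.add hC, hφ', hdφ', hH.add hBt, ?_, ?_, ?_, ?_, ?_⟩
  · rw [d3_add, dH, d3_d2 hB, add_zero]
  · intro α hα
    dsimp only
    rw [h1 α hα, C_sharp hP.1 hB hα, ← hP.1.1]
    congr 1; funext Z; exact (hα.1 _ _).symm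
  · intro α β hα hβ
    funext Z
    rw [concom_add hP.1 hα hβ, h2 α β hα hβ, concom_C hP hB hα hβ]
    simp only [Pi.add_apply]; ring
  · intro X Y
    rw [torsion_add hA hC, h3, T, TC, ← hP.1.1, ← hP.1.1]
    congr 1; funext Z
    simp only [Pi.add_apply, Pi.sub_apply, hH.add1, hH.add2, hBt.add1, hBt.add2]
    ring
  · have hE := (isTwoForm_bb hB hA hA).add ((isTwoForm_bb hB hA hA).add ((isTwoForm_bb hB hA hA).add
      ((isTwoForm_bb hB hA hC).add ((isTwoForm_bb hB hA hC).add ((isTwoForm_bb hB hA hC).add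
      (isTwoForm_bb hB hC hC))))))
    have key : (6 : ℝ) • (iota3 (fun X => A X + P (B X))
          (φ - d2 (lcomp B fun X => P (B X)) - d2 (iota2 A B))
          + cyc (H + d2 B) (fun X => A X + P (B X)) (fun X => A X + P (B X)))
        = (6 : ℝ) • (iota3 A φ + cyc H A A) - d2 (bb B A A + (bb B A A + (bb B A A +
          (bb B A (fun X => P (B X)) + (bb B A (fun X => P (B X)) + (bb B A (fun X => P (B X))
          + bb B (fun X => P (B X)) (fun X => P (B X)))))))) := by
      funext X Y Z
      have F1 := F2 hB hA hA X Y Z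
      have F3 := F2 hB hA hC X Y Z
      have F4 := F2 hB hC hC X Y Z
      have PB : ∀ {ω : Cov1 IM M}, IsOneForm ω → ∀ Z, B (P ω) Z = ω (P (B Z)) :=
        fun hω Z => (pair_C hP.1 hB hω Z).symm
      have w1 : ∀ X Y, IsOneForm (fun Z => φ X Y Z + H (A X) Y Z + H X (A Y) Z) :=
        fun X Y => ((hφ.1 X Y).add (hH.1 _ _)).add (hH.1 _ _)
      have w2 : ∀ X Y, IsOneForm (fun Z => - d2 (iota2 A B) X Y Z + d2 B (A X) Y Z
          + d2 B X (A Y) Z + H (P (B X)) Y Z + H X (P (B Y)) Z) :=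
        fun X Y => (((((hit.1 X Y).neg).add (hBt.1 _ _)).add (hBt.1 _ _)).add (hH.1 _ _)).add
          (hH.1 _ _)
      have w3 : ∀ X Y, IsOneForm (fun Z => - d2 (lcomp B (fun X => P (B X))) X Y Z
          + d2 B (P (B X)) Y Z + d2 B X (P (B Y)) Z) :=
        fun X Y => (((hlt.1 X Y).neg).add (hBt.1 _ _)).add (hBt.1 _ _)
      rw [tors2_self A, tors2_self A, tors2_self A, h3, h3, h3, hB.addl, hB.addl, hB.addl,
        PB (w1 _ _), PB (w1 _ _), PB (w1 _ _)] at F1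
      rw [T, T, T, PB (w2 _ _), PB (w2 _ _), PB (w2 _ _), iota2_C hP.1 hB, d2_add] at F3
      rw [tors2_self (fun X => P (B X)), tors2_self (fun X => P (B X)), tors2_self (fun X => P (B X)), TC, TC, TC, hB.addl, hB.addl, hB.addl,
        PB (w3 _ _), PB (w3 _ _), PB (w3 _ _), iota2_C hP.1 hB, d2_add] at F4
      have s1 := cyc_sum1 (C := fun X => P (B X)) hφ X Y Z
      have s2 := cyc_sum2 (A := A) (C := fun X => P (B X)) hH X Y Z
      have s3 := cyc_sum1 (C := fun X => P (B X)) hit X Y Z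
      have s4 := cyc_sum2 (A := A) (C := fun X => P (B X)) hBt X Y Z
      have s5 := cyc_sum2 (A := fun X => P (B X)) (C := fun X => P (B X)) hH X Y Z
      have s6 := cyc_sum1 (C := fun X => P (B X)) hlt X Y Z
      have s7 := cyc_sum2 (A := fun X => P (B X)) (C := fun X => P (B X)) hBt X Y Z
      have i2 : ∀ (S : VF IM M → VF IM M) (ψ χ : Cov3 IM M),
          iota3 S (ψ + χ) X Y Z = iota3 S ψ X Y Z + iota3 S χ X Y Z := by
        intro S ψ χ; simp only [iota3, Pi.add_apply]; ring
      have i3 : ∀ (S : VF IM M → VF IM M) (ψ χ : Cov3 IM M),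
          iota3 S (ψ - χ) X Y Z = iota3 S ψ X Y Z - iota3 S χ X Y Z := by
        intro S ψ χ; simp only [iota3, Pi.sub_apply]; ring
      have c2 : ∀ (S S' : VF IM M → VF IM M) (ψ χ : Cov3 IM M),
          cyc (ψ + χ) S S' X Y Z = cyc ψ S S' X Y Z + cyc χ S S' X Y Z := by
        intro S S' ψ χ; simp only [cyc, Pi.add_apply]; ring
      have six : ∀ f : SmoothR IM M, (6 : ℝ) • f = 6 * f := by
        intro f
        rw [show (6 : ℝ) = ((6 : ℕ) : ℝ) by norm_num, Nat.cast_smul_eq_nsmul, nsmul_eq_mul]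
        norm_num
      rw [i2] at F3 F4
      simp only [d2_add, Pi.add_apply, Pi.sub_apply, Pi.smul_apply, six]
      rw [iota3_add hφ', cyc_add (hH.add hBt)]
      simp only [i2, i3, c2]
      linear_combination 3 * F1 + 3 * F3 + F4 - 6 * s1 - 6 * s2 + 3 * s3 - 3 * s4 - 3 * s5
        + 2 * s6 - 2 * s7
    have d := congrArg d3 key
    rw [d3_smul, d3_sub, d3_smul, d3_d2 hE, sub_zero] at d
    have d' := smul_right_injective _ (show (6 : ℝ) ≠ 0 by norm_num) d
    have z4 : ∀ S : VF IM M → VF IM M, iota4 S (0 : Cov4 IM M) = 0 := by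
      intro S; funext X Y Z W; simp [iota4]
    unfold dA3 at h4 ⊢
    rw [dφ, z4, zero_sub] at h4
    rw [hdφ', z4, zero_sub]
    rw [d3_add, d3_add, ← h4, add_neg_cancel] at d'
    exact neg_eq_of_add_eq_zero_right d'

end Preservation
section GroupLaw

lemma lcomp_zero_right {B : Cov2 IM M} (hB : IsTwoForm B) :
    lcomp B (fun _ => (0 : VF IM M)) = 0 := by
  funext X Y
  exact (hB.2.1 Y).map_zero'

lemma IsTwoForm.neg {B : Cov2 IM M} (h : IsTwoForm B) : IsTwoForm (-B) :=
  ⟨fun X => (h.1 X).neg, fun Y => (h.2.1 Y).neg, fun X => by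
    simp only [Pi.neg_apply, h.2.2, neg_zero]⟩

lemma gauge_comp {B₁ B₂ : Cov2 IM M} (h₁ : IsTwoForm B₁) (h₂ : IsTwoForm B₂)
    {q : PqNbQuad IM M} (hq : IsPqNbQ q) :
    gaugeT B₁ (gaugeT B₂ q) = gaugeT (B₁ + B₂) q := by
  obtain ⟨P, A, φ, H⟩ := q
  have hP : IsBivector P := hq.1.1
  have key : lcomp B₁ (fun X => P (B₁ X)) + iota2 (fun X => A X + P (B₂ X)) B₁
      + (lcomp B₂ (fun X => P (B₂ X)) + iota2 A B₂)
      = lcomp (B₁ + B₂) (fun X => P ((B₁ + B₂) X)) + iota2 A (B₁ + B₂) := by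
    funext X Y
    have e1 : B₂ (P (B₁ X)) Y = B₁ X (P (B₂ Y)) := (pair_C hP h₂ (h₁.1 X) Y).symm
    simp only [Pi.add_apply, lcomp, iota2, hP.1, h₁.addl, h₂.addl, (h₁.1 X).1, e1]
    ring
  have k2 := congrArg d2 key
  simp only [d2_add] at k2
  simp only [gaugeT, Prod.mk.injEq, true_and]
  refine ⟨?_, ?_, ?_⟩
  · funext X
    rw [Pi.add_apply, hP.1]
    abel
  · rw [sub_sub, sub_sub _ (d2 (lcomp (B₁ + B₂) _)), ← k2]
    abel
  · rw [d2_add]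
    abel

lemma gaugeT_zero_eq {q : PqNbQuad IM M} (hq : IsPqNbQ q) : gaugeT (0 : Cov2 IM M) q = q := by
  obtain ⟨P, A, φ, H⟩ := q
  have hP : IsBivector P := hq.1.1
  have e1 : lcomp (0 : Cov2 IM M) (fun X => P ((0 : Cov2 IM M) X)) = 0 := rfl
  have e2 : iota2 A (0 : Cov2 IM M) = 0 := by
    funext X Y
    simp [iota2]
  simp only [gaugeT, Prod.mk.injEq, true_and, e1, e2, d2_zero, sub_zero, add_zero, and_true]
  funext X
  rw [Pi.zero_apply, hP.zero, add_zero]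

lemma isThreeForm_zero : IsThreeForm (0 : Cov3 IM M) := by
  refine ⟨fun X Y => ⟨?_, ?_⟩, fun X Y => ⟨?_, ?_⟩, fun X Y => ⟨?_, ?_⟩, ?_, ?_, ?_⟩ <;> intros <;>
    simp

lemma d3_zero : d3 (0 : Cov3 IM M) = 0 := by
  funext X Y Z W
  simp [d3]

lemma dA3_zero (A : VF IM M → VF IM M) : dA3 A (0 : Cov3 IM M) = d3 (cyc 0 A A) := by
  have e1 : iota3 A (0 : Cov3 IM M) = 0 := by
    funext X Y Z
    simp [iota3]
  have e2 : cyc (0 : Cov3 IM M) A A = 0 := by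
    funext X Y Z
    simp [cyc]
  rw [dA3, e1, e2, d3_zero]
  funext X Y Z W
  simp [iota4]

lemma pqnb_scalar (f : SmoothR IM M) :
    IsPqNb (fun _ : Cov1 IM M => (0 : VF IM M)) (fun X => f • X) 0 0 := by
  refine ⟨⟨⟨?_, ?_, ?_⟩, ?_⟩, ⟨?_, ?_⟩, isThreeForm_zero, d3_zero, isThreeForm_zero, d3_zero,
    ?_, ?_, ?_, dA3_zero _⟩
  · intros; simp
  · intros; simp
  · intro α β hα hβ
    rw [hα.map_zero', hβ.map_zero', neg_zero]
  · intros; simp [pbracket]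
  · intros; simp
  · intro g X
    exact smul_comm f g X
  · intros; simp
  · intro α β hα hβ
    funext Z
    have z : ∀ W : VF IM M, ⁅(0 : VF IM M), W⁆ = 0 := fun W => zero_lie W
    simp [concom, lieDer, transp, dF, bivFun, z, hα.map_zero', hβ.map_zero']
  · intro X Y
    refine Derivation.ext fun g => ?_
    simp only [torsion, smul_lie', lie_smul', Derivation.sub_apply, Derivation.add_apply,
      Derivation.smul_apply, smul_eq_mul, Derivation.zero_apply]
    ring

lemma pqnb_poisson {P : Cov1 IM M → VF IM M} (h : IsPoisson P) :
    IsPqNb P (fun _ => (0 : VF IM M)) 0 0 := by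
  refine ⟨h, ⟨?_, ?_⟩, isThreeForm_zero, d3_zero, isThreeForm_zero, d3_zero,
    ?_, ?_, ?_, dA3_zero _⟩
  · intros; simp
  · intros; simp
  · intro α hα
    have : transp (fun _ => (0 : VF IM M)) α = 0 := funext fun X => hα.map_zero'
    rw [this, h.1.zero]
  · intro α β hα hβ
    have e1 : transp (fun _ => (0 : VF IM M)) α = 0 := funext fun X => hα.map_zero'
    have e2 : transp (fun _ => (0 : VF IM M)) β = 0 := funext fun X => hβ.map_zero'
    funext Z
    simp only [concom, e1, e2, bivFun, h.1.zero, hβ.map_zero']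
    have z : ∀ W : VF IM M, ⁅W, (0 : VF IM M)⁆ = 0 := fun W => lie_zero W
    simp [lieDer, transp, dF, z, hα.map_zero', hβ.map_zero']
  · intro X Y
    have e : (fun Z => (0 : Cov3 IM M) X Y Z + (0 : Cov3 IM M) 0 Y Z + (0 : Cov3 IM M) X 0 Z)
        = (0 : Cov1 IM M) := by
      funext Z
      simp
    have z : ⁅(0 : VF IM M), (0 : VF IM M)⁆ = 0 := lie_self _
    rw [e, h.1.zero]
    simp [torsion, z]

lemma poisson_rank2 (w a b : SmoothR IM M) (X Y : VF IM M)
    (hw : w • ⁅X, Y⁆ = a • X + b • Y) :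
    IsPoisson (fun α : Cov1 IM M => (w * α X) • Y - (w * α Y) • X) := by
  refine ⟨⟨?_, ?_, ?_⟩, ?_⟩
  · intro α β
    refine Derivation.ext fun g => ?_
    simp only [Pi.add_apply, Derivation.sub_apply, Derivation.add_apply,
      Derivation.smul_apply, smul_eq_mul]
    ring
  · intro f α
    refine Derivation.ext fun g => ?_
    simp only [Pi.smul_apply, Derivation.sub_apply, Derivation.add_apply,
      Derivation.smul_apply, smul_eq_mul]
    ring
  · intro α β hα hβ
    rw [hα.map_sub', hβ.map_sub', hα.2, hα.2, hβ.2, hβ.2]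
    ring
  · intro f g h
    have e : ∀ u : SmoothR IM M, w * (X (Y u) - Y (X u)) = a * X u + b * Y u := fun u => by
      have := congrArg (fun D : VF IM M => D u) hw
      simpa only [Derivation.smul_apply, Derivation.add_apply, Derivation.commutator_apply,
        smul_eq_mul] using this
    simp only [pbracket, dF, Derivation.sub_apply, Derivation.smul_apply, smul_eq_mul, map_sub,
      Derivation.leibniz]
    linear_combination w * (X f * Y g - Y f * X g) * e h + w * (X g * Y h - Y g * X h) * e f
      + w * (X h * Y f - Y h * X f) * e g

lemma smoothR_pow_eq_zero {w : SmoothR IM M} (h : w * w * w = 0) : w = 0 := by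
  ext x
  have := congrArg (fun u : SmoothR IM M => u x) h
  have h' : w x * w x * w x = 0 := this
  have : w x = 0 := by simpa using h'
  simpa using this

lemma gauge_inj {B B' : Cov2 IM M} (hB : IsTwoForm B) (hB' : IsTwoForm B')
    (h0 : ∀ q : PqNbQuad IM M, IsPqNbQ q → gaugeT B q = gaugeT B' q) : B = B' := by
  have h : ∀ {P : Cov1 IM M → VF IM M} {A : VF IM M → VF IM M} {φ H : Cov3 IM M},
      IsPqNb P A φ H → gaugeT B (P, A, φ, H) = gaugeT B' (P, A, φ, H) :=
    fun {P A φ H} hq => h0 (P, A, φ, H) hq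
  obtain ⟨D, hD⟩ : ∃ D, D = B + -B' := ⟨_, rfl⟩
  have tD : IsTwoForm D := hD ▸ hB.add hB'.neg
  have d0 : d2 D = 0 := by
    have := congrArg (fun q => q.2.2.2) (h (pqnb_scalar (IM := IM) (M := M) 0))
    simp only [gaugeT, zero_add] at this
    have e : d2 B = d2 D + d2 B' := by
      rw [← d2_add, hD, neg_add_cancel_right]
    rw [e] at this
    simpa using this
  have wedge : ∀ (f : SmoothR IM M) X Y Z,
      X f * D Y Z - Y f * D X Z + Z f * D X Y = 0 := by
    intro f X Y Z
    have h1 := congrArg (fun q => q.2.2.1) (h (pqnb_scalar f))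
    simp only [gaugeT, lcomp_zero_right hB, lcomp_zero_right hB', d2_zero, sub_zero,
      zero_sub, neg_inj] at h1
    have e : iota2 (fun X => f • X) B
        = iota2 (fun X => f • X) D + iota2 (fun X => f • X) B' := by
      funext X Y
      simp only [hD, iota2, Pi.add_apply, Pi.neg_apply]
      ring
    rw [e, d2_add] at h1
    have h2 : d2 (iota2 (fun X => f • X) D) = 0 := by simpa using h1
    have h3 := congrFun (congrFun (congrFun h2 X) Y) Z
    have h4 := congrFun (congrFun (congrFun d0 X) Y) Z
    simp only [d2, iota2, tD.smull, (tD.1 _).2, map_add, Derivation.leibniz, smul_eq_mul,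
      Pi.zero_apply] at h3 h4
    have h5 : (2 : ℝ) • (X f * D Y Z - Y f * D X Z + Z f * D X Y) = 0 := by
      rw [two_smul]
      linear_combination h3 - 2 * f * h4
    exact (smul_eq_zero.mp h5).resolve_left two_ne_zero
  have Dz : ∀ X Y, D X Y = 0 := by
    intro X Y
    obtain ⟨w, hw⟩ : ∃ w, w = D X Y := ⟨_, rfl⟩
    have hsp : w • ⁅X, Y⁆ = (- D Y ⁅X, Y⁆) • X + (D X ⁅X, Y⁆) • Y := by
      refine Derivation.ext fun g => ?_
      have := wedge g X Y ⁅X, Y⁆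
      simp only [Derivation.add_apply, Derivation.smul_apply, smul_eq_mul, hw]
      linear_combination this
    have hP := poisson_rank2 w _ _ X Y hsp
    have h1 := congrArg (fun q => q.2.1 X) (h (pqnb_poisson hP))
    simp only [gaugeT, zero_add, hB.2.2, hB'.2.2, mul_zero, zero_smul, zero_sub, neg_inj] at h1
    have h2 := congrArg (fun Z => D Z Y) h1
    simp only [tD.smull] at h2
    rw [← hw]
    apply smoothR_pow_eq_zero
    have hw' : w = B X Y - B' X Y := by
      rw [hw, hD]
      simp only [Pi.add_apply, Pi.neg_apply]
      ring
    rw [← hw] at h2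
    linear_combination h2 + w * w * hw'
  funext X Y
  have := Dz X Y
  rw [hD] at this
  simp only [Pi.add_apply, Pi.neg_apply] at this
  linear_combination this

end GroupLaw

/-- **Theorem 3.11 (the group of gauge transformations).**  Gauge transformations map
the class `𝔠_{PqNb}(M)` to itself and form an abelian group under composition:
`𝔊(B₁) ∘ 𝔊(B₂) = 𝔊(B₁ + B₂)`, the identity is `𝔊(0)`, the inverse of `𝔊(B)` is
`𝔊(-B)`, and `𝔊` is a group isomorphism from `(Ω²(M), +)` onto `(Gauge(M), ∘)`
(in particular `𝔊` is injective, so `Gauge(M)` is in bijection with `Ω²(M)`). -/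
theorem gauge_transformations_abelian_group :
    -- gauge transformations preserve the class of PqNb structures
    (∀ B : Cov2 IM M, IsTwoForm B → ∀ q : PqNbQuad IM M, IsPqNbQ q →
      IsPqNbQ (gaugeT B q)) ∧
    -- composition law : 𝔊(B₁) ∘ 𝔊(B₂) = 𝔊(B₁ + B₂) on 𝔠_{PqNb}(M)
    (∀ B₁ B₂ : Cov2 IM M, IsTwoForm B₁ → IsTwoForm B₂ →
      ∀ q : PqNbQuad IM M, IsPqNbQ q → gaugeT B₁ (gaugeT B₂ q) = gaugeT (B₁ + B₂) q) ∧
    -- commutativity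
    (∀ B₁ B₂ : Cov2 IM M, IsTwoForm B₁ → IsTwoForm B₂ →
      ∀ q : PqNbQuad IM M, IsPqNbQ q → gaugeT B₁ (gaugeT B₂ q) = gaugeT B₂ (gaugeT B₁ q)) ∧
    -- 𝔊(0) is the identity
    (∀ q : PqNbQuad IM M, IsPqNbQ q → gaugeT (0 : Cov2 IM M) q = q) ∧
    -- 𝔊(-B) is the inverse of 𝔊(B)
    (∀ B : Cov2 IM M, IsTwoForm B →
      ∀ q : PqNbQuad IM M, IsPqNbQ q → gaugeT (-B) (gaugeT B q) = q) ∧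
    -- 𝔊 is injective (hence an isomorphism onto its image Gauge(M))
    (∀ B B' : Cov2 IM M, IsTwoForm B → IsTwoForm B' →
      (∀ q : PqNbQuad IM M, IsPqNbQ q → gaugeT B q = gaugeT B' q) → B = B') := by
  refine ⟨fun B hB q hq => preserve hB hq, fun B₁ B₂ h₁ h₂ q hq => gauge_comp h₁ h₂ hq,
    fun B₁ B₂ h₁ h₂ q hq => ?_, fun q hq => gaugeT_zero_eq hq, fun B hB q hq => ?_,
    fun B B' hB hB' h => gauge_inj hB hB' h⟩
  · rw [gauge_comp h₁ h₂ hq, gauge_comp h₂ h₁ hq, add_comm]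
  · rw [gauge_comp hB.neg hB hq, neg_add_cancel, gaugeT_zero_eq hq]

end
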